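/- Let k > 0 and choose constants a₁ = a₂ = 2/k and a₁₂ > max(1, a₁², a₂²). Then for all real numbers p₁, p₂, p₁₂ (representing V₁f, V₂f, V₁₂f) and q₁, q₂, q₁₂, r₁, r₂, r₁₂ (representing the second derivatives V₁²f, V₂²f, V₁V₁₂f, V₂V₁f, V₁V₂f, V₂V₁₂f appropriately), the quadratic expression -2a₁q₁² - 2a₁r₂² - 2a₁k p₁² - 2a₂q₂² - 2a₂r₁² - 2a₂k p₂² - 2a₁₂ q₁₂² - 2a₁₂ r₁₂² - 4a₁₂ k p₁₂² + 4a₁ r₁₂ p₁ - 4a₂ q₁₂ p₂ is at most -k(a₁p₁² + a₂p₂² + a₁₂ p₁₂²). -/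

import Mathlib

/-- Young's inequality with a coefficient `a` whose square is at most `b`. -/
theorem two_mul_mul_le_of_sq_le {a b : ℝ} (h : a ^ 2 ≤ b) (x y : ℝ) :
    2 * a * x * y ≤ b * x ^ 2 + y ^ 2 := by
  nlinarith [sq_nonneg (y - a * x), mul_le_mul_of_nonneg_right h (sq_nonneg x)]

/-- algebraic core of the UFG-Heisenberg estimate.  With
`k > 0`, `a₁ = a₂ = 2/k` and `a₁₂ > max(1, a₁², a₂²)`, the quadratic
expression is bounded by `-k(a₁p₁² + a₂p₂² + a₁₂p₁₂²)` for all reals. -/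
theorem heisenberg_quadratic_estimate (k a₁ a₂ a₁₂ : ℝ) (hk : 0 < k)
    (ha₁ : a₁ = 2 / k) (ha₂ : a₂ = 2 / k)
    (ha₁₂ : a₁₂ > max 1 (max (a₁ ^ 2) (a₂ ^ 2))) :
    ∀ p₁ p₂ p₁₂ q₁ q₂ q₁₂ r₁ r₂ r₁₂ : ℝ,
      -2 * a₁ * q₁ ^ 2 - 2 * a₁ * r₂ ^ 2 - 2 * a₁ * k * p₁ ^ 2
        - 2 * a₂ * q₂ ^ 2 - 2 * a₂ * r₁ ^ 2 - 2 * a₂ * k * p₂ ^ 2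
        - 2 * a₁₂ * q₁₂ ^ 2 - 2 * a₁₂ * r₁₂ ^ 2 - 4 * a₁₂ * k * p₁₂ ^ 2
        + 4 * a₁ * r₁₂ * p₁ - 4 * a₂ * q₁₂ * p₂
      ≤ -k * (a₁ * p₁ ^ 2 + a₂ * p₂ ^ 2 + a₁₂ * p₁₂ ^ 2) := by
  intro p₁ p₂ p₁₂ q₁ q₂ q₁₂ r₁ r₂ r₁₂
  obtain ⟨hb, hb₁, hb₂⟩ : 1 < a₁₂ ∧ a₁ ^ 2 < a₁₂ ∧ a₂ ^ 2 < a₁₂ := by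
    simpa only [gt_iff_lt, max_lt_iff] using ha₁₂
  have hak₁ : a₁ * k = 2 := by rw [ha₁, div_mul_cancel₀ _ hk.ne']
  have hak₂ : a₂ * k = 2 := by rw [ha₂, div_mul_cancel₀ _ hk.ne']
  have ha₁_pos : 0 < a₁ := ha₁ ▸ div_pos two_pos hk
  have ha₂_pos : 0 < a₂ := ha₂ ▸ div_pos two_pos hk
  have ha₁₂_pos : 0 < a₁₂ := one_pos.trans hb
  have hq₁ : 0 ≤ a₁ * q₁ ^ 2 := by positivity
  have hr₂ : 0 ≤ a₁ * r₂ ^ 2 := by positivity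
  have hq₂ : 0 ≤ a₂ * q₂ ^ 2 := by positivity
  have hr₁ : 0 ≤ a₂ * r₁ ^ 2 := by positivity
  have hp₁₂ : 0 ≤ a₁₂ * k * p₁₂ ^ 2 := by positivity
  have hcross₁ := two_mul_mul_le_of_sq_le hb₁.le r₁₂ p₁
  have hcross₂ := two_mul_mul_le_of_sq_le hb₂.le q₁₂ (-p₂)
  linear_combination 2 * hq₁ + 2 * hr₂ + 2 * hq₂ + 2 * hr₁ + 3 * hp₁₂ + 2 * hcross₁ +
    2 * hcross₂ - p₁ ^ 2 * hak₁ - p₂ ^ 2 * hak₂
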